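/- There exists a constant C > 0 such that for every i ≥ 1 and every k ≥ 0, ‖R_i·R_{i+2}·⋯·R_{i+2k} − L‖_F ≤ C·(exp(∑_{l=0}^{k} ‖R_{i+2l} − L‖_F) − 1). -/

import Mathlib

open Filter Finset Matrix

/-- The golden ratio φ = (1+√5)/2. -/
noncomputable def goldphi : ℝ := (1 + Real.sqrt 5) / 2

/-- The matrix `A`: identity in rows 1–7, row 8 = (0,0,0,0,0,1,1,1,1),
row 9 = (0,0,0,1,1,2,0,1,2). -/
def Amat : Matrix (Fin 9) (Fin 9) ℝ :=
  !![1,0,0,0,0,0,0,0,0;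
     0,1,0,0,0,0,0,0,0;
     0,0,1,0,0,0,0,0,0;
     0,0,0,1,0,0,0,0,0;
     0,0,0,0,1,0,0,0,0;
     0,0,0,0,0,1,0,0,0;
     0,0,0,0,0,0,1,0,0;
     0,0,0,0,0,1,1,1,1;
     0,0,0,1,1,2,0,1,2]

/-- The matrix `M` with rows e₆, e₉, e₈, e₂, e₄+e₅, e₇, e₁+e₃, e₃, e₄. -/
def Mmat : Matrix (Fin 9) (Fin 9) ℝ :=
  !![0,0,0,0,0,1,0,0,0;
     0,0,0,0,0,0,0,0,1;
     0,0,0,0,0,0,0,1,0;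
     0,1,0,0,0,0,0,0,0;
     0,0,0,1,1,0,0,0,0;
     0,0,0,0,0,0,1,0,0;
     1,0,1,0,0,0,0,0,0;
     0,0,1,0,0,0,0,0,0;
     0,0,0,1,0,0,0,0,0]

/-- The rank-one limit matrix `L`, nonzero only in rows 2 and 3. -/
noncomputable def Lmat : Matrix (Fin 9) (Fin 9) ℝ :=
  !![0,0,0,0,0,0,0,0,0;
     (Real.sqrt 5 - 1)/4, 1/2, (1 + Real.sqrt 5)/4, (3 + Real.sqrt 5)/4, 1/2, 0, (3 + Real.sqrt 5)/4, 0, 0;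
     (3 - Real.sqrt 5)/4, (Real.sqrt 5 - 1)/4, 1/2, (1 + Real.sqrt 5)/4, (Real.sqrt 5 - 1)/4, 0, (1 + Real.sqrt 5)/4, 0, 0;
     0,0,0,0,0,0,0,0,0;
     0,0,0,0,0,0,0,0,0;
     0,0,0,0,0,0,0,0,0;
     0,0,0,0,0,0,0,0,0;
     0,0,0,0,0,0,0,0,0;
     0,0,0,0,0,0,0,0,0]

/-- `a_i = r_i - 1`. -/
def aseq (r : ℕ → ℕ) (i : ℕ) : ℕ := r i - 1

/-- `c_i = (2/√5)·φ^{2 a_i}`. -/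
noncomputable def cseq (r : ℕ → ℕ) (i : ℕ) : ℝ :=
  (2 / Real.sqrt 5) * goldphi ^ (2 * aseq r i)

/-- `P_i = A^{a_i} M A^{a_{i+1}} M`. -/
noncomputable def Pmat (r : ℕ → ℕ) (i : ℕ) : Matrix (Fin 9) (Fin 9) ℝ :=
  Amat ^ (aseq r i) * Mmat * Amat ^ (aseq r (i+1)) * Mmat

/-- `R_i = P_i / c_{i+1}`. -/
noncomputable def Rmat (r : ℕ → ℕ) (i : ℕ) : Matrix (Fin 9) (Fin 9) ℝ :=
  (cseq r (i+1))⁻¹ • Pmat r i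

/-- The Frobenius norm of a square real matrix. -/
noncomputable def frobNorm {n : ℕ} (X : Matrix (Fin n) (Fin n) ℝ) : ℝ :=
  Real.sqrt (∑ i, ∑ j, (X i j)^2)

/-- The hypotheses on the sequence `r`: `r 1 = 1`, `r 2 = 2`, and the sequence of
differences `n ↦ r (n+1) - r n` (for `n ≥ 1`) is strictly increasing. -/
def GoodSeq (r : ℕ → ℕ) : Prop :=
  r 1 = 1 ∧ r 2 = 2 ∧ ∀ n, 1 ≤ n → r (n+1) - r n < r (n+2) - r (n+1)

attribute [local instance] Matrix.frobeniusNormedRing Matrix.frobeniusNormedAlgebra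

lemma frobNorm_eq (X : Matrix (Fin 9) (Fin 9) ℝ) : frobNorm X = ‖X‖ := by
  rw [Matrix.frobenius_norm_def, frobNorm, Real.sqrt_eq_rpow]
  simp

/-- Products of perturbations of an idempotent in a normed ring. -/
lemma prod_perturb {B : Type*} [NormedRing B] (L : B) (hL : L * L = L) (b : ℝ) (h1 : 1 ≤ b)
    (hb1 : ‖(1 : B)‖ ≤ b) (hbL : ‖L‖ ≤ b) (R : ℕ → B) (n : ℕ) :
    ‖((List.range n).map R).prod‖ ≤ b * ∏ l ∈ Finset.range n, (1 + b * ‖R l - L‖) ∧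
    ‖((List.range n).map R).prod * L‖ ≤ b * ∏ l ∈ Finset.range n, (1 + b * ‖R l - L‖) ∧
    ‖((List.range n).map R).prod * L - L‖
      ≤ b * (∏ l ∈ Finset.range n, (1 + b * ‖R l - L‖) - 1) := by
  induction n with
  | zero => simpa using ⟨hb1, hbL⟩
  | succ n ih =>
    obtain ⟨i1, i2, i3⟩ := ih
    rw [List.range_succ, List.map_append, List.prod_append, Finset.prod_range_succ]
    simp only [List.map_cons, List.map_nil, List.prod_cons, List.prod_nil, mul_one]
    set Q := ((List.range n).map R).prod
    set X := ∏ l ∈ Finset.range n, (1 + b * ‖R l - L‖)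
    set E := R n - L with hE
    have hR : R n = L + E := by simp [hE]
    have he := norm_nonneg E
    have hQE : ‖Q * E‖ ≤ b * X * ‖E‖ :=
      (norm_mul_le _ _).trans (mul_le_mul_of_nonneg_right i1 he)
    have hX : 0 ≤ b * X := (norm_nonneg _).trans i1
    have hXe : 0 ≤ b * X * ‖E‖ := mul_nonneg hX he
    have hQEL : ‖Q * E * L‖ ≤ b * X * ‖E‖ * b :=
      (norm_mul_le _ _).trans (mul_le_mul hQE hbL (norm_nonneg _) hXe)
    have hbb : b * X * ‖E‖ ≤ b * X * ‖E‖ * b := le_mul_of_one_le_right hXe h1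
    have e1 : Q * R n = Q * L + Q * E := by rw [hR, mul_add]
    have e2 : Q * R n * L = Q * L + Q * E * L := by rw [e1, add_mul, mul_assoc, hL]
    have e3 : Q * R n * L - L = (Q * L - L) + Q * E * L := by rw [e2]; abel
    refine ⟨?_, ?_, ?_⟩
    · rw [e1]
      refine (norm_add_le _ _).trans ?_
      linarith
    · rw [e2]
      refine (norm_add_le _ _).trans ?_
      linarith
    · rw [e3]
      refine (norm_add_le _ _).trans ?_
      linarith

lemma prod_perturb_sub {B : Type*} [NormedRing B] (L : B) (hL : L * L = L) (b : ℝ) (h1 : 1 ≤ b)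
    (hb1 : ‖(1 : B)‖ ≤ b) (hbL : ‖L‖ ≤ b) (R : ℕ → B) (n : ℕ) :
    ‖((List.range (n + 1)).map R).prod - L‖
      ≤ b * (Real.exp (b * ∑ l ∈ Finset.range (n + 1), ‖R l - L‖) - 1) := by
  obtain ⟨i1, i2, i3⟩ := prod_perturb L hL b h1 hb1 hbL R n
  have key : ‖((List.range (n + 1)).map R).prod - L‖
      ≤ b * (∏ l ∈ Finset.range (n + 1), (1 + b * ‖R l - L‖) - 1) := by
    rw [List.range_succ, List.map_append, List.prod_append, Finset.prod_range_succ]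
    simp only [List.map_cons, List.map_nil, List.prod_cons, List.prod_nil, mul_one]
    set Q := ((List.range n).map R).prod
    set X := ∏ l ∈ Finset.range n, (1 + b * ‖R l - L‖)
    set E := R n - L with hE
    have hR : R n = L + E := by simp [hE]
    have he := norm_nonneg E
    have hQE : ‖Q * E‖ ≤ b * X * ‖E‖ :=
      (norm_mul_le _ _).trans (mul_le_mul_of_nonneg_right i1 he)
    have hX : 0 ≤ b * X := (norm_nonneg _).trans i1
    have hXe : 0 ≤ b * X * ‖E‖ := mul_nonneg hX he
    have hbb : b * X * ‖E‖ ≤ b * X * ‖E‖ * b := le_mul_of_one_le_right hXe h1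
    have e1 : Q * R n - L = (Q * L - L) + Q * E := by rw [hR, mul_add]; abel
    rw [e1]
    refine (norm_add_le _ _).trans ?_
    linarith
  refine key.trans ?_
  have : ∏ l ∈ Finset.range (n + 1), (1 + b * ‖R l - L‖)
      ≤ Real.exp (b * ∑ l ∈ Finset.range (n + 1), ‖R l - L‖) := by
    rw [Finset.mul_sum, Real.exp_sum]
    refine Finset.prod_le_prod (fun l _ => by positivity) (fun l _ => ?_)
    linarith [Real.add_one_le_exp (b * ‖R l - L‖)]
  have hb : 0 ≤ b := by linarith
  gcongr

lemma exp_compare (b s S : ℝ) (hb : 0 ≤ b) (hs : 0 ≤ s) (hS : s ≤ S) :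
    Real.exp (b * s) - 1 ≤ b * Real.exp (b * S) * (Real.exp s - 1) := by
  have h1 : Real.exp (b * s) - 1 ≤ b * s * Real.exp (b * s) := by
    have := Real.add_one_le_exp (-(b * s))
    have h2 : Real.exp (-(b * s)) * Real.exp (b * s) = 1 := by
      rw [← Real.exp_add]; simp
    nlinarith [Real.exp_pos (b * s)]
  have h2 : s ≤ Real.exp s - 1 := by linarith [Real.add_one_le_exp s]
  calc _ ≤ b * s * Real.exp (b * s) := h1
    _ = b * Real.exp (b * s) * s := by ring
    _ ≤ _ := by gcongr

/-- `A - 1`. -/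
def Vmat : Matrix (Fin 9) (Fin 9) ℝ :=
  !![0,0,0,0,0,0,0,0,0;
     0,0,0,0,0,0,0,0,0;
     0,0,0,0,0,0,0,0,0;
     0,0,0,0,0,0,0,0,0;
     0,0,0,0,0,0,0,0,0;
     0,0,0,0,0,0,0,0,0;
     0,0,0,0,0,0,0,0,0;
     0,0,0,0,0,1,1,0,1;
     0,0,0,1,1,2,0,1,1]

/-- `(A - 1)^2`. -/
def Wmat : Matrix (Fin 9) (Fin 9) ℝ :=
  !![0,0,0,0,0,0,0,0,0;
     0,0,0,0,0,0,0,0,0;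
     0,0,0,0,0,0,0,0,0;
     0,0,0,0,0,0,0,0,0;
     0,0,0,0,0,0,0,0,0;
     0,0,0,0,0,0,0,0,0;
     0,0,0,0,0,0,0,0,0;
     0,0,0,1,1,2,0,1,1;
     0,0,0,1,1,3,1,1,2]

lemma A_eq : Amat = 1 + Vmat := by
  ext i j; fin_cases i <;> fin_cases j <;> norm_num [Amat, Vmat, Matrix.one_apply]

set_option maxHeartbeats 2000000 in
lemma VV : Vmat * Vmat = Wmat := by
  ext i j; fin_cases i <;> fin_cases j <;>
    norm_num [Vmat, Wmat, Matrix.mul_apply, Fin.sum_univ_succ]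

set_option maxHeartbeats 2000000 in
lemma VW : Vmat * Wmat = Wmat + Vmat := by
  ext i j; fin_cases i <;> fin_cases j <;>
    norm_num [Vmat, Wmat, Matrix.mul_apply, Fin.sum_univ_succ]

set_option maxHeartbeats 2000000 in
lemma VMV : Vmat * (Mmat * Vmat) = 0 := by
  ext i j; fin_cases i <;> fin_cases j <;>
    norm_num [Vmat, Mmat, Matrix.mul_apply, Fin.sum_univ_succ]

lemma s5 : Real.sqrt 5 * Real.sqrt 5 = 5 := Real.mul_self_sqrt (by norm_num)

set_option maxHeartbeats 2000000 in
lemma L_idem : Lmat * Lmat = Lmat := by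
  have h := s5
  ext i j; fin_cases i <;> fin_cases j <;>
    simp [Lmat, Matrix.mul_apply, Fin.sum_univ_succ] <;> grind

/-- Spectral projection for `φ²`. -/
noncomputable def A1 : Matrix (Fin 9) (Fin 9) ℝ :=
  ((5 - Real.sqrt 5) / 10) • (Wmat + ((Real.sqrt 5 - 1) / 2) • Vmat)

/-- Spectral projection for `φ⁻²`. -/
noncomputable def A2 : Matrix (Fin 9) (Fin 9) ℝ :=
  ((5 + Real.sqrt 5) / 10) • (Wmat - ((Real.sqrt 5 + 1) / 2) • Vmat)

set_option maxHeartbeats 2000000 in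
lemma L_eq : (Real.sqrt 5 / 2) • (Mmat * A1 * Mmat) = Lmat := by
  have h := s5
  ext i j; fin_cases i <;> fin_cases j <;>
    simp [Lmat, A1, Mmat, Wmat, Vmat, Matrix.mul_apply, Fin.sum_univ_succ] <;> grind

lemma V_A1 : Vmat * A1 = ((1 + Real.sqrt 5) / 2) • A1 := by
  have h := s5
  rw [A1, Matrix.mul_smul, Matrix.mul_add, Matrix.mul_smul, VW, VV]
  ext i j
  simp
  grind

lemma V_A2 : Vmat * A2 = ((1 - Real.sqrt 5) / 2) • A2 := by
  have h := s5
  rw [A2, Matrix.mul_smul, Matrix.mul_sub, Matrix.mul_smul, VW, VV]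
  ext i j
  simp
  grind

lemma V_sum : ((1 + Real.sqrt 5) / 2) • A1 + ((1 - Real.sqrt 5) / 2) • A2 = Vmat := by
  have h := s5
  rw [A1, A2]
  ext i j
  simp
  grind

lemma A_pow (n : ℕ) : Amat ^ n = (1 - A1 - A2) + (((3 + Real.sqrt 5) / 2) ^ n) • A1
    + (((3 - Real.sqrt 5) / 2) ^ n) • A2 := by
  induction n with
  | zero => simp only [pow_zero, one_smul]; abel
  | succ n ih =>
    have e0 : Vmat * (1 - A1 - A2) = 0 := by
      rw [Matrix.mul_sub, Matrix.mul_sub, V_A1, V_A2, Matrix.mul_one, sub_sub, V_sum, sub_self]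
    rw [pow_succ', ih, A_eq, Matrix.add_mul, Matrix.one_mul, Matrix.mul_add, Matrix.mul_add, e0,
      Matrix.mul_smul, Matrix.mul_smul, V_A1, V_A2, pow_succ, pow_succ]
    module

lemma A_pow_V (n : ℕ) : ∃ G, Amat ^ n = 1 + Vmat * G ∧ Amat ^ n = 1 + G * Vmat := by
  have hc : Commute Vmat Amat := by rw [A_eq]; exact (Commute.one_right _).add_right rfl
  induction n with
  | zero => exact ⟨0, by simp⟩
  | succ n ih =>
    obtain ⟨G, h1, h2⟩ := ih
    refine ⟨G * Amat + 1, ?_, ?_⟩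
    · rw [pow_succ, h1]
      nth_rewrite 1 [A_eq]
      rw [A_eq]; noncomm_ring
    · rw [pow_succ, h2, Matrix.add_mul, Matrix.add_mul, Matrix.mul_assoc, hc.eq,
        ← Matrix.mul_assoc, Matrix.one_mul, Matrix.one_mul]
      nth_rewrite 1 [A_eq]
      abel

lemma P_eq (m n : ℕ) : Amat ^ m * Mmat * Amat ^ n * Mmat
    = Amat ^ m * (Mmat * Mmat) + Mmat * Amat ^ n * Mmat - Mmat * Mmat := by
  obtain ⟨G, -, h1⟩ := A_pow_V m
  obtain ⟨H, h2, -⟩ := A_pow_V n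
  have : (G * Vmat) * Mmat * (Vmat * H) = 0 := by
    have : (G * Vmat) * Mmat * (Vmat * H) = G * (Vmat * (Mmat * Vmat)) * H := by noncomm_ring
    rw [this, VMV]; simp
  have e : Amat ^ m * Mmat * Amat ^ n * Mmat
    = Amat ^ m * (Mmat * Mmat) + Mmat * Amat ^ n * Mmat - Mmat * Mmat
      + (Amat ^ m - 1) * Mmat * (Amat ^ n - 1) * Mmat := by noncomm_ring
  rw [e, h1, h2, add_sub_cancel_left, add_sub_cancel_left, this]
  simp

lemma goldphi_sq : goldphi ^ 2 = (3 + Real.sqrt 5) / 2 := by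
  have h := s5
  unfold goldphi; grind

lemma R_est : ∃ K : ℝ, 0 ≤ K ∧ ∀ m n : ℕ,
    ‖(2 / Real.sqrt 5 * goldphi ^ (2 * n))⁻¹ • (Amat ^ m * Mmat * Amat ^ n * Mmat) - Lmat‖
      ≤ K * (goldphi ^ (2 * m) / goldphi ^ (2 * n)) := by
  have h5 : 2 ≤ Real.sqrt 5 := Real.le_sqrt_of_sq_le (by norm_num)
  have h5' : Real.sqrt 5 ≤ 3 := Real.sqrt_le_iff.2 (by norm_num)
  refine ⟨Real.sqrt 5 / 2 * ((‖(1 - A1 - A2)‖ + ‖A1‖ + ‖A2‖) * ‖Mmat * Mmat‖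
    + (‖Mmat * (1 - A1 - A2) * Mmat‖ + ‖Mmat * A2 * Mmat‖ + ‖Mmat * Mmat‖)), by positivity, ?_⟩
  intro m n
  rw [pow_mul, pow_mul, goldphi_sq, P_eq]
  set g := (3 + Real.sqrt 5) / 2 with hg
  have hg1 : 1 ≤ g := by rw [hg]; linarith
  have hx : 1 ≤ g ^ m := one_le_pow₀ hg1
  have hy : 1 ≤ g ^ n := one_le_pow₀ hg1
  have hz (k : ℕ) : ‖((3 - Real.sqrt 5) / 2) ^ k‖ ≤ 1 := by
    rw [norm_pow]
    refine pow_le_one₀ (norm_nonneg _) ?_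
    rw [Real.norm_eq_abs, abs_le]; constructor <;> linarith
  have hA : ‖Amat ^ m‖ ≤ (‖(1 - A1 - A2)‖ + ‖A1‖ + ‖A2‖) * g ^ m := by
    rw [A_pow]
    refine (norm_add₃_le).trans ?_
    rw [norm_smul, norm_smul, ← hg, Real.norm_of_nonneg (by positivity : 0 ≤ g ^ m)]
    have := mul_le_mul_of_nonneg_right (hz m) (norm_nonneg A2)
    nlinarith [norm_nonneg A2, norm_nonneg (1 - A1 - A2)]
  have key : (2 / Real.sqrt 5 * g ^ n)⁻¹ • (Amat ^ m * (Mmat * Mmat) + Mmat * Amat ^ n * Mmat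
      - Mmat * Mmat) - Lmat = (Real.sqrt 5 / 2 * (g ^ n)⁻¹) • (Amat ^ m * (Mmat * Mmat)
      + (Mmat * (1 - A1 - A2) * Mmat + (((3 - Real.sqrt 5) / 2) ^ n) • (Mmat * A2 * Mmat)
        - Mmat * Mmat)) := by
    have hM : Mmat * Amat ^ n * Mmat = Mmat * (1 - A1 - A2) * Mmat + g ^ n • (Mmat * A1 * Mmat)
        + (((3 - Real.sqrt 5) / 2) ^ n) • (Mmat * A2 * Mmat) := by
      rw [A_pow, Matrix.mul_add, Matrix.mul_add, Matrix.add_mul, Matrix.add_mul,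
        Matrix.mul_smul, Matrix.mul_smul, Matrix.smul_mul, Matrix.smul_mul]
    have hc : (2 / Real.sqrt 5 * g ^ n)⁻¹ = Real.sqrt 5 / 2 * (g ^ n)⁻¹ := by
      rw [mul_inv, inv_div]
    have hL : Lmat = (Real.sqrt 5 / 2 * (g ^ n)⁻¹) • (g ^ n • (Mmat * A1 * Mmat)) := by
      rw [smul_smul, mul_assoc, inv_mul_cancel₀ (by positivity), mul_one, L_eq]
    rw [hc, hL, hM, ← smul_sub]
    congr 1
    abel
  rw [key, norm_smul, Real.norm_of_nonneg (by positivity)]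
  have hB : ‖Amat ^ m * (Mmat * Mmat)
      + (Mmat * (1 - A1 - A2) * Mmat + (((3 - Real.sqrt 5) / 2) ^ n) • (Mmat * A2 * Mmat)
        - Mmat * Mmat)‖ ≤ ((‖(1 - A1 - A2)‖ + ‖A1‖ + ‖A2‖) * ‖Mmat * Mmat‖
    + (‖Mmat * (1 - A1 - A2) * Mmat‖ + ‖Mmat * A2 * Mmat‖ + ‖Mmat * Mmat‖)) * g ^ m := by
    have t1 : ‖Amat ^ m * (Mmat * Mmat)‖
        ≤ (‖(1 - A1 - A2)‖ + ‖A1‖ + ‖A2‖) * g ^ m * ‖Mmat * Mmat‖ :=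
      (norm_mul_le _ _).trans (mul_le_mul_of_nonneg_right hA (norm_nonneg _))
    have t2 : ‖(((3 - Real.sqrt 5) / 2) ^ n) • (Mmat * A2 * Mmat)‖ ≤ ‖Mmat * A2 * Mmat‖ := by
      rw [norm_smul]
      exact mul_le_of_le_one_left (norm_nonneg _) (hz n)
    have t3 : ‖Mmat * (1 - A1 - A2) * Mmat + (((3 - Real.sqrt 5) / 2) ^ n) • (Mmat * A2 * Mmat)
        - Mmat * Mmat‖ ≤ ‖Mmat * (1 - A1 - A2) * Mmat‖ + ‖Mmat * A2 * Mmat‖ + ‖Mmat * Mmat‖ := by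
      refine (norm_sub_le _ _).trans ?_
      gcongr
      refine (norm_add_le _ _).trans ?_
      gcongr
    have t4 := t3.trans (le_mul_of_one_le_right (by positivity) hx)
    refine (norm_add_le _ _).trans ?_
    linarith
  calc _ ≤ Real.sqrt 5 / 2 * (g ^ n)⁻¹ * _ := mul_le_mul_of_nonneg_left hB (by positivity)
    _ = _ := by rw [div_eq_mul_inv (g ^ m)]; ring

lemma good_diff (r : ℕ → ℕ) (hr : GoodSeq r) (n : ℕ) : r (n + 1) + (n + 1) ≤ r (n + 2) := by
  obtain ⟨h1, h2, h3⟩ := hr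
  have : n + 1 ≤ r (n + 2) - r (n + 1) := by
    induction n with
    | zero => simp [h1, h2]
    | succ n ih =>
      have := h3 (n + 1) (by omega)
      simp only [add_assoc, Nat.reduceAdd] at *
      omega
  omega

lemma ratio_le (r : ℕ → ℕ) (hr : GoodSeq r) (i : ℕ) (hi : 1 ≤ i) :
    goldphi ^ (2 * aseq r i) / goldphi ^ (2 * aseq r (i + 1)) ≤ (1 / 2) ^ i := by
  have h5 : 2 ≤ Real.sqrt 5 := Real.le_sqrt_of_sq_le (by norm_num)
  have hg : 2 ≤ goldphi ^ 2 := by rw [goldphi_sq]; linarith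
  obtain ⟨n, rfl⟩ : ∃ n, i = n + 1 := ⟨i - 1, by omega⟩
  have hd := good_diff r hr n
  have hpos : ∀ m, 1 ≤ r (m + 1) := by
    intro m
    induction m with
    | zero => simp [hr.1]
    | succ m ih => have := good_diff r hr m; simp only [add_assoc, Nat.reduceAdd] at *; omega
  have hp := hpos n
  rw [pow_mul, pow_mul]
  have hle : aseq r (n + 1) + (n + 1) ≤ aseq r (n + 1 + 1) := by
    unfold aseq; simp only [add_assoc, Nat.reduceAdd] at *; omega
  have h1 : (goldphi ^ 2) ^ (aseq r (n + 1)) * 2 ^ (n + 1)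
      ≤ (goldphi ^ 2) ^ (aseq r (n + 1 + 1)) := by
    calc _ ≤ (goldphi ^ 2) ^ (aseq r (n + 1)) * (goldphi ^ 2) ^ (n + 1) := by gcongr
      _ = (goldphi ^ 2) ^ (aseq r (n + 1) + (n + 1)) := (pow_add _ _ _).symm
      _ ≤ _ := pow_le_pow_right₀ (by linarith) hle
  have hP : 0 < (goldphi ^ 2) ^ (aseq r (n + 1 + 1)) := by positivity
  rw [one_div, inv_pow, ← one_div, div_le_div_iff₀ hP (by positivity), one_mul]
  exact h1

/-- `‖R_i R_{i+2} ⋯ R_{i+2k} − L‖_F ≤ C (exp(∑_{l=0}^k ‖R_{i+2l} − L‖_F) − 1)`. -/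
theorem stmt4 (r : ℕ → ℕ) (hr : GoodSeq r) :
    ∃ C : ℝ, 0 < C ∧ ∀ i : ℕ, 1 ≤ i → ∀ k : ℕ,
      frobNorm (((List.range (k+1)).map (fun l => Rmat r (i + 2*l))).prod - Lmat)
        ≤ C * (Real.exp (∑ l ∈ Finset.range (k+1), frobNorm (Rmat r (i + 2*l) - Lmat)) - 1) := by
  obtain ⟨K, hK, hest⟩ := R_est
  have hE : ∀ i, 1 ≤ i → ‖Rmat r i - Lmat‖ ≤ K * (1 / 2) ^ i := fun i hi =>
    (hest (aseq r i) (aseq r (i + 1))).trans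
      (mul_le_mul_of_nonneg_left (ratio_le r hr i hi) hK)
  set b : ℝ := 1 + ‖(1 : Matrix (Fin 9) (Fin 9) ℝ)‖ + ‖Lmat‖ with hb
  have n1 := norm_nonneg (1 : Matrix (Fin 9) (Fin 9) ℝ)
  have n2 := norm_nonneg Lmat
  have hb1 : 1 ≤ b := by linarith
  have hb0 : 0 < b := by linarith
  refine ⟨b * (b * Real.exp (b * (K * 2))), by positivity, ?_⟩
  intro i hi k
  simp only [frobNorm_eq]
  refine (prod_perturb_sub Lmat L_idem b hb1 (by linarith) (by linarith)
    (fun l => Rmat r (i + 2 * l)) k).trans ?_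
  rw [mul_assoc]
  refine mul_le_mul_of_nonneg_left ?_ hb0.le
  refine exp_compare _ _ _ hb0.le (Finset.sum_nonneg fun _ _ => norm_nonneg _) ?_
  calc _ ≤ ∑ l ∈ Finset.range (k + 1), K * (1 / 2 : ℝ) ^ l := by
        refine Finset.sum_le_sum fun l _ => (hE _ (by omega)).trans ?_
        refine mul_le_mul_of_nonneg_left ?_ hK
        exact pow_le_pow_of_le_one (by norm_num) (by norm_num) (by omega)
    _ = K * ∑ l ∈ Finset.range (k + 1), (1 / 2 : ℝ) ^ l := (Finset.mul_sum _ _ _).symm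
    _ ≤ K * 2 := mul_le_mul_of_nonneg_left (sum_geometric_two_le _) hK
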